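/- arXiv:1012.5863 — 2 statements merged into one kernel-verified Lean document; each statement's English description precedes it below -/
import Mathlib

section
/- Let 0 < p ≤ 2 and 0 < α ≤ 1, and equip ℝⁿ with the metric d(x,y) = ‖x − y‖_p^{α·min{1,p}}, where ‖x‖_p = (Σ_{j=1}^n |x_j|^p)^{1/p}. Let A ⊆ ℝⁿ be a nonempty compact set. Then the magnitude of A (with the metric d) is finite: there exists a constant C > 0 such that for every finite signed Borel measure μ on A, μ(A)² ≤ C · ∫_A ∫_A exp(−d(x,y)) dμ(x) dμ(y). -/
open MeasureTheory Metric
open scoped ENNReal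

/-- Integral of a real-valued function against a finite signed Borel measure. -/
noncomputable def sInt {A : Type*} [MeasurableSpace A] (μ : SignedMeasure A) (f : A → ℝ) : ℝ :=
  ∫ x, f x ∂μ.toJordanDecomposition.posPart - ∫ x, f x ∂μ.toJordanDecomposition.negPart

/-- The metric `d(x,y) = ‖x - y‖_p^{α·min{1,p}}` on `ℝⁿ`, where
`‖x‖_p = (Σ |x_j|^p)^{1/p}`. -/
noncomputable def pDist (p α : ℝ) {n : ℕ} (x y : Fin n → ℝ) : ℝ :=
  ((∑ j, |x j - y j| ^ p) ^ (1 / p)) ^ (α * min 1 p)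

/-- Positive semidefinite kernel on `S`, tested on finite families of points. -/
def PSDK {E : Type} (S : Set E) (k : E → E → ℝ) : Prop :=
  (∀ x ∈ S, ∀ y ∈ S, k x y = k y x) ∧
  ∀ (ι : Type) [Fintype ι] (x : ι → E) (c : ι → ℝ), (∀ i, x i ∈ S) →
    0 ≤ ∑ i, ∑ j, c i * c j * k (x i) (x j)

namespace PSDK

variable {E : Type} {S : Set E} {k l : E → E → ℝ}

theorem congr' (h : PSDK S k) (e : ∀ x ∈ S, ∀ y ∈ S, k x y = l x y) : PSDK S l := by
  refine ⟨fun x hx y hy => ?_, fun ι _ x c hx => ?_⟩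
  · rw [← e x hx y hy, ← e y hy x hx]; exact h.1 x hx y hy
  · have := h.2 ι x c hx
    refine this.trans_eq ?_
    refine Finset.sum_congr rfl fun i _ => Finset.sum_congr rfl fun j _ => ?_
    rw [e _ (hx i) _ (hx j)]

theorem add (hk : PSDK S k) (hl : PSDK S l) : PSDK S (fun x y => k x y + l x y) := by
  refine ⟨fun x hx y hy => ?_, fun ι _ x c hx => ?_⟩
  · simp only [hk.1 x hx y hy, hl.1 x hx y hy]
  · have h1 := hk.2 ι x c hx
    have h2 := hl.2 ι x c hx
    simp only [mul_add, Finset.sum_add_distrib]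
    linarith

theorem smul (hk : PSDK S k) {a : ℝ} (ha : 0 ≤ a) : PSDK S (fun x y => a * k x y) := by
  refine ⟨fun x hx y hy => ?_, fun ι _ x c hx => ?_⟩
  · simp only [hk.1 x hx y hy]
  · have h1 := mul_nonneg ha (hk.2 ι x c hx)
    refine h1.trans_eq ?_
    simp only [Finset.mul_sum]
    refine Finset.sum_congr rfl fun i _ => Finset.sum_congr rfl fun j _ => ?_
    ring

theorem rankOne (f : E → ℝ) : PSDK S (fun x y => f x * f y) := by
  refine ⟨fun x hx y hy => mul_comm _ _, fun ι _ x c hx => ?_⟩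
  have : ∑ i, ∑ j, c i * c j * (f (x i) * f (x j)) = (∑ i, c i * f (x i)) ^ 2 := by
    rw [sq, Finset.sum_mul_sum]
    refine Finset.sum_congr rfl fun i _ => Finset.sum_congr rfl fun j _ => ?_
    ring
  rw [this]; positivity

theorem const {a : ℝ} (ha : 0 ≤ a) : PSDK S (fun _ _ => a) := by
  have := (rankOne (S := S) (fun _ => (1 : ℝ))).smul ha
  simpa using this

theorem posSemidef (hk : PSDK S k) {ι : Type} [Fintype ι] (x : ι → E) (hx : ∀ i, x i ∈ S) :
    (Matrix.of fun i j => k (x i) (x j)).PosSemidef := by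
  refine Matrix.PosSemidef.of_dotProduct_mulVec_nonneg ?_ ?_
  · ext i j
    simp [hk.1 (x j) (hx j) (x i) (hx i)]
  · intro c
    refine (hk.2 ι x c hx).trans_eq ?_
    simp only [dotProduct, Matrix.mulVec, Finset.mul_sum, Matrix.of_apply, Pi.star_apply,
      star_trivial]
    refine Finset.sum_congr rfl fun i _ => Finset.sum_congr rfl fun j _ => ?_
    ring

theorem mul (hk : PSDK S k) (hl : PSDK S l) : PSDK S (fun x y => k x y * l x y) := by
  refine ⟨fun x hx y hy => ?_, fun ι _ x c hx => ?_⟩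
  · simp only [hk.1 x hx y hy, hl.1 x hx y hy]
  · have h := ((hk.posSemidef x hx).hadamard (hl.posSemidef x hx)).dotProduct_mulVec_nonneg c
    refine h.trans_eq ?_
    simp only [dotProduct, Matrix.mulVec, Finset.mul_sum, Matrix.of_apply, Pi.star_apply,
      star_trivial, Matrix.hadamard_apply]
    refine Finset.sum_congr rfl fun i _ => Finset.sum_congr rfl fun j _ => ?_
    ring

theorem pow (hk : PSDK S k) (m : ℕ) : PSDK S (fun x y => k x y ^ m) := by
  induction m with
  | zero => simpa using const (S := S) zero_le_one
  | succ m ih => simpa only [pow_succ] using ih.mul hk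

theorem finsetSum {κ : Type*} (s : Finset κ) (f : κ → E → E → ℝ) (h : ∀ a ∈ s, PSDK S (f a)) :
    PSDK S (fun x y => ∑ a ∈ s, f a x y) := by
  classical
  induction s using Finset.induction_on with
  | empty => simpa using const (S := S) le_rfl
  | insert a s ha ih =>
    simp only [Finset.sum_insert ha]
    exact (h a (by simp)).add (ih fun b hb => h b (by simp [hb]))

theorem lim {κ : Type*} {F : Filter κ} [F.NeBot] (f : κ → E → E → ℝ) (h : ∀ a, PSDK S (f a))
    (ht : ∀ x ∈ S, ∀ y ∈ S, Filter.Tendsto (fun a => f a x y) F (nhds (k x y))) : PSDK S k := by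
  refine ⟨fun x hx y hy => ?_, fun ι _ x c hx => ?_⟩
  · refine tendsto_nhds_unique (ht x hx y hy) ?_
    simpa only [(h _).1 x hx y hy] using ht y hy x hx
  · refine ge_of_tendsto' (f := fun a => ∑ i, ∑ j, c i * c j * f a (x i) (x j)) (x := F) ?_
      (fun a => (h a).2 ι x c hx)
    refine tendsto_finsetSum _ fun i _ => tendsto_finsetSum _ fun j _ => ?_
    exact (ht _ (hx i) _ (hx j)).const_mul _

theorem hasSum (f : ℕ → E → E → ℝ) (h : ∀ a, PSDK S (f a))
    (ht : ∀ x ∈ S, ∀ y ∈ S, HasSum (fun a => f a x y) (k x y)) : PSDK S k :=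
  lim (F := Filter.atTop) (fun s x y => ∑ a ∈ Finset.range s, f a x y)
    (fun _ => finsetSum _ _ fun a _ => h a)
    (fun x hx y hy => (ht x hx y hy).tendsto_sum_nat)

theorem integral {Ω : Type*} [MeasurableSpace Ω] {ν : Measure Ω} (f : Ω → E → E → ℝ)
    (h : ∀ᵐ a ∂ν, PSDK S (f a)) (hi : ∀ x ∈ S, ∀ y ∈ S, Integrable (fun a => f a x y) ν) :
    PSDK S (fun x y => ∫ a, f a x y ∂ν) := by
  refine ⟨fun x hx y hy => ?_, fun ι _ x c hx => ?_⟩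
  · refine integral_congr_ae ?_
    filter_upwards [h] with a ha using ha.1 x hx y hy
  · have : ∑ i, ∑ j, c i * c j * ∫ a, f a (x i) (x j) ∂ν
        = ∫ a, ∑ i, ∑ j, c i * c j * f a (x i) (x j) ∂ν := by
      rw [integral_finsetSum]
      · refine Finset.sum_congr rfl fun i _ => ?_
        rw [integral_finsetSum]
        · refine Finset.sum_congr rfl fun j _ => ?_
          rw [integral_const_mul]
        · exact fun j _ => (hi _ (hx i) _ (hx j)).const_mul _
      · exact fun i _ => integrable_finsetSum _ fun j _ => (hi _ (hx i) _ (hx j)).const_mul _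
    rw [this]
    refine integral_nonneg_of_ae ?_
    filter_upwards [h] with a ha using ha.2 ι x c hx

/-- If `M - s` is PSD, then `exp (-s) - exp (-M)` is PSD. -/
theorem exp_sub {s : E → E → ℝ} {M : ℝ} (h : PSDK S (fun x y => M - s x y)) :
    PSDK S (fun x y => Real.exp (-s x y) - Real.exp (-M)) := by
  have h1 : PSDK S (fun x y => Real.exp (M - s x y) - 1) := by
    refine hasSum (fun m x y => ((m + 1).factorial : ℝ)⁻¹ * (M - s x y) ^ (m + 1))
      (fun m => (h.pow (m + 1)).smul (by positivity)) ?_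
    intro x _ y _
    have := NormedSpace.expSeries_div_hasSum_exp (M - s x y)
    rw [← Real.exp_eq_exp_ℝ, ← hasSum_nat_add_iff' 1] at this
    simpa [div_eq_inv_mul] using this
  refine (h1.smul (Real.exp_pos (-M)).le).congr' fun x _ y _ => ?_
  rw [mul_sub, ← Real.exp_add]
  ring_nf

theorem inv_sub {s : E → E → ℝ} {M t : ℝ} (ht : 0 < t) (h : PSDK S (fun x y => M - s x y))
    (h0 : ∀ x ∈ S, ∀ y ∈ S, 0 ≤ s x y) (h1 : ∀ x ∈ S, ∀ y ∈ S, s x y ≤ M) (hM : 0 ≤ M) :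
    PSDK S (fun x y => (t + s x y)⁻¹ - (t + M)⁻¹) := by
  have hp : 0 < t + M := by linarith
  refine hasSum (fun m x y => ((t + M) ^ (m + 2))⁻¹ * (M - s x y) ^ (m + 1))
      (fun m => (h.pow (m + 1)).smul (by positivity)) ?_
  intro x hx y hy
  have a0 := h0 x hx y hy
  have a1 := h1 x hx y hy
  have hr : 0 ≤ (M - s x y) / (t + M) := div_nonneg (by linarith) hp.le
  have hr1 : (M - s x y) / (t + M) < 1 := by rw [div_lt_one hp]; linarith
  have := (hasSum_geometric_of_lt_one hr hr1).mul_left ((M - s x y) / (t + M) ^ 2)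
  have h2 : 1 - (M - s x y) / (t + M) = (t + s x y) / (t + M) := by field_simp; ring
  have h3 : t + s x y ≠ 0 := by positivity
  have h4 : (M - s x y) / (t + M) ^ 2 * (1 - (M - s x y) / (t + M))⁻¹
      = (t + s x y)⁻¹ - (t + M)⁻¹ := by
    rw [h2]
    field_simp
    ring
  rw [h4] at this
  refine this.congr_fun ?_
  intro m
  rw [div_pow]
  field_simp
  ring

theorem rpow_sub {s : E → E → ℝ} {B : ℝ} {β : ℝ} (hβ0 : 0 < β) (hβ1 : β ≤ 1)
    (h : ∃ M, PSDK S (fun x y => M - s x y))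
    (h0 : ∀ x ∈ S, ∀ y ∈ S, 0 ≤ s x y) (h1 : ∀ x ∈ S, ∀ y ∈ S, s x y ≤ B) :
    ∃ M, PSDK S (fun x y => M - s x y ^ β) := by
  obtain ⟨M0, hM0⟩ := h
  rcases hβ1.eq_or_lt with rfl | hβ1
  · exact ⟨M0, by simpa using hM0⟩
  set M := max M0 (max B 0) with hMdef
  have hM : 0 ≤ M := by simp [hMdef]
  have hMB : B ≤ M := by simp [hMdef]
  have hMM : PSDK S (fun x y => M - s x y) :=
    ((const (S := S) (sub_nonneg.2 (le_max_left M0 (max B 0)))).add hM0).congr'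
      fun x _ y _ => by ring
  obtain ⟨ν, hν⟩ := Real.exists_measure_rpow_eq_integral_rpowIntegrand₀₁ (p := β) ⟨hβ0, hβ1⟩
  refine ⟨M ^ β, ?_⟩
  have key : PSDK S (fun x y => ∫ t in Set.Ioi (0 : ℝ),
      (Real.rpowIntegrand₀₁ β t M - Real.rpowIntegrand₀₁ β t (s x y)) ∂ν) := by
    refine integral _ ?_ ?_
    · refine (ae_restrict_iff' measurableSet_Ioi).2 (Filter.Eventually.of_forall fun t ht => ?_)
      have ht' : (0 : ℝ) < t := ht
      refine ((inv_sub ht' hMM h0 (fun x hx y hy => (h1 x hx y hy).trans hMB) hM).smul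
        (Real.rpow_nonneg ht'.le β)).congr' fun x _ y _ => ?_
      unfold Real.rpowIntegrand₀₁
      ring
    · intro x hx y hy
      exact (hν M hM).1.sub (hν _ (h0 x hx y hy)).1
  refine key.congr' fun x hx y hy => ?_
  rw [integral_sub (hν M hM).1 (hν _ (h0 x hx y hy)).1, ← (hν M hM).2,
    ← (hν _ (h0 x hx y hy)).2]

end PSDK

section MeasureStage

variable {E : Type} [MeasurableSpace E]

theorem integral_comp_simpleFunc (P : Measure E) [IsFiniteMeasure P] (s : SimpleFunc E E)
    (g : E → ℝ) : ∫ x, g (s x) ∂P = ∑ v ∈ s.range, P.real (s ⁻¹' {v}) * g v := by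
  have h : ∀ x, g (s x) = ∑ v ∈ s.range, (s ⁻¹' {v}).indicator (fun _ => g v) x := by
    intro x
    rw [Finset.sum_eq_single (s x)]
    · simp
    · intro b _ hb
      have : x ∉ s ⁻¹' {b} := fun h => hb (by simpa using (Set.mem_preimage.1 h).symm)
      simp [this]
    · intro h; exact absurd (s.mem_range_self x) h
  simp_rw [h]
  rw [integral_finsetSum]
  · refine Finset.sum_congr rfl fun v _ => ?_
    rw [integral_indicator_const _ (s.measurableSet_fiber v), smul_eq_mul]
  · intro v _
    exact (integrable_const _).indicator (s.measurableSet_fiber v)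

theorem sInt_comp_simpleFunc (μ : SignedMeasure E) (s : SimpleFunc E E) (g : E → ℝ) :
    sInt μ (fun x => g (s x)) = ∑ v ∈ s.range,
      (μ.toJordanDecomposition.posPart.real (s ⁻¹' {v})
        - μ.toJordanDecomposition.negPart.real (s ⁻¹' {v})) * g v := by
  unfold sInt
  rw [integral_comp_simpleFunc, integral_comp_simpleFunc, ← Finset.sum_sub_distrib]
  refine Finset.sum_congr rfl fun v _ => by ring

theorem sInt_sInt_simpleFunc_nonneg {A : Set E} {k : E → E → ℝ} (hk : PSDK A k)
    (μ : SignedMeasure E) (s : SimpleFunc E E) (hs : ∀ x, s x ∈ A) :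
    0 ≤ sInt μ (fun x => sInt μ (fun y => k (s x) (s y))) := by
  have h1 := sInt_comp_simpleFunc μ s (fun v => sInt μ (fun y => k v (s y)))
  rw [h1]
  simp_rw [fun v => sInt_comp_simpleFunc μ s (k v)]
  set w : E → ℝ := fun v => μ.toJordanDecomposition.posPart.real (s ⁻¹' {v})
        - μ.toJordanDecomposition.negPart.real (s ⁻¹' {v}) with hw
  have h2 := hk.2 s.range (fun v => v.1) (fun v => w v.1) (by
    rintro ⟨v, hv⟩
    obtain ⟨x, rfl⟩ := SimpleFunc.mem_range.1 hv
    exact hs x)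
  refine h2.trans_eq ?_
  rw [← Finset.sum_coe_sort s.range]
  refine Finset.sum_congr rfl fun v _ => ?_
  rw [← Finset.sum_coe_sort s.range, Finset.mul_sum]
  refine Finset.sum_congr rfl fun u _ => ?_
  ring

theorem sInt_tendsto {μ : SignedMeasure E} {A : Set E} (hμ : μ.totalVariation Aᶜ = 0)
    {f : ℕ → E → ℝ} {g : E → ℝ} {B : ℝ} (hf : ∀ m, Measurable (f m))
    (hB : ∀ m x, |f m x| ≤ B)
    (ht : ∀ x ∈ A, Filter.Tendsto (fun m => f m x) Filter.atTop (nhds (g x))) :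
    Filter.Tendsto (fun m => sInt μ (f m)) Filter.atTop (nhds (sInt μ g)) := by
  have hP : μ.toJordanDecomposition.posPart Aᶜ = 0 ∧ μ.toJordanDecomposition.negPart Aᶜ = 0 := by
    simpa [SignedMeasure.totalVariation] using hμ
  have key : ∀ (P : Measure E) [IsFiniteMeasure P], P Aᶜ = 0 →
      Filter.Tendsto (fun m => ∫ x, f m x ∂P) Filter.atTop (nhds (∫ x, g x ∂P)) := by
    intro P _ hPA
    refine tendsto_integral_of_dominated_convergence (fun _ => B)
      (fun m => (hf m).aestronglyMeasurable) (integrable_const _) ?_ ?_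
    · exact fun m => Filter.Eventually.of_forall fun x => hB m x
    · have : ∀ᵐ x ∂P, x ∈ A := by
        rw [ae_iff]; exact hPA
      filter_upwards [this] with x hx using ht x hx
  exact (key _ hP.1).sub (key _ hP.2)

theorem abs_sInt_le (μ : SignedMeasure E) {f : E → ℝ} {B : ℝ} (hB : ∀ x, |f x| ≤ B) :
    |sInt μ f| ≤ B * μ.toJordanDecomposition.posPart.real Set.univ
      + B * μ.toJordanDecomposition.negPart.real Set.univ := by
  unfold sInt
  refine (abs_sub _ _).trans (add_le_add ?_ ?_)
  · exact norm_integral_le_of_norm_le_const (f := f) (Filter.Eventually.of_forall hB)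
  · exact norm_integral_le_of_norm_le_const (f := f) (Filter.Eventually.of_forall hB)

theorem measurable_sInt (μ : SignedMeasure E) {f : E → E → ℝ}
    (hf : Measurable (Function.uncurry f)) : Measurable (fun x => sInt μ (f x)) := by
  unfold sInt
  exact (hf.stronglyMeasurable.integral_prod_right).measurable.sub
    (hf.stronglyMeasurable.integral_prod_right).measurable

end MeasureStage

theorem sInt_sInt_nonneg {n : ℕ} {A : Set (Fin n → ℝ)} (hA : IsCompact A) (hAne : A.Nonempty)
    {k : (Fin n → ℝ) → (Fin n → ℝ) → ℝ} (hk : PSDK A k) (hc : Continuous (Function.uncurry k))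
    (μ : SignedMeasure (Fin n → ℝ)) (hμ : μ.totalVariation Aᶜ = 0) :
    0 ≤ sInt μ (fun x => sInt μ (fun y => k x y)) := by
  obtain ⟨a0, ha0⟩ := hAne
  obtain ⟨B, hB⟩ := (hA.prod hA).exists_bound_of_continuousOn hc.continuousOn
  set s : ℕ → SimpleFunc (Fin n → ℝ) (Fin n → ℝ) :=
    SimpleFunc.approxOn id measurable_id A a0 ha0 with hs
  have hsA : ∀ m x, s m x ∈ A := fun m x => SimpleFunc.approxOn_mem measurable_id ha0 m x
  have hst : ∀ x ∈ A, Filter.Tendsto (fun m => s m x) Filter.atTop (nhds x) := fun x hx =>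
    SimpleFunc.tendsto_approxOn measurable_id ha0 (subset_closure hx)
  have hb : ∀ m x y, |k (s m x) (s m y)| ≤ B := fun m x y => hB (s m x, s m y) ⟨hsA m x, hsA m y⟩
  have hmeas : ∀ m, Measurable (Function.uncurry fun x y => k (s m x) (s m y)) := by
    intro m
    exact hc.measurable.comp (((s m).measurable.comp measurable_fst).prodMk
      ((s m).measurable.comp measurable_snd))
  refine ge_of_tendsto' (x := Filter.atTop)
    (f := fun m => sInt μ (fun x => sInt μ (fun y => k (s m x) (s m y)))) ?_
    (fun m => sInt_sInt_simpleFunc_nonneg hk μ (s m) (hsA m))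
  refine sInt_tendsto hμ (fun m => measurable_sInt μ (hmeas m))
    (fun m x => abs_sInt_le μ (hb m x)) ?_
  intro x hx
  refine sInt_tendsto hμ (fun m => (hmeas m).comp measurable_prodMk_left) (fun m => hb m x) ?_
  intro y hy
  exact (hc.tendsto (x, y)).comp ((hst x hx).prodMk_nhds (hst y hy))

theorem sInt_const {E : Type} [MeasurableSpace E] (μ : SignedMeasure E) (a : ℝ) :
    sInt μ (fun _ => a) = a * μ Set.univ := by
  rw [SignedMeasure.apply_eq_posPart_real_sub_negPart_real μ MeasurableSet.univ]
  unfold sInt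
  simp [integral_const]
  ring

theorem sInt_sub_const {E : Type} [MeasurableSpace E] (μ : SignedMeasure E) (f : E → ℝ) (a B : ℝ)
    (hf : Measurable f) (hB : ∀ x, |f x| ≤ B) :
    sInt μ (fun x => f x - a) = sInt μ f - a * μ Set.univ := by
  rw [← sInt_const]
  unfold sInt
  have hi : ∀ (P : Measure E) [IsFiniteMeasure P], Integrable f P := fun P _ =>
    (integrable_const B).mono' hf.aestronglyMeasurable (Filter.Eventually.of_forall hB)
  rw [integral_sub (hi _) (integrable_const _), integral_sub (hi _) (integrable_const _)]
  ring

theorem final_of_psd {n : ℕ} {A : Set (Fin n → ℝ)} (hA : IsCompact A) (hAne : A.Nonempty)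
    {d : (Fin n → ℝ) → (Fin n → ℝ) → ℝ} (hd : Continuous (Function.uncurry d))
    (hd0 : ∀ x y, 0 ≤ d x y) {M : ℝ} (hM : PSDK A (fun x y => M - d x y)) :
    ∃ C : ℝ, 0 < C ∧
      ∀ μ : SignedMeasure (Fin n → ℝ), μ.totalVariation Aᶜ = 0 →
        (μ Set.univ) ^ 2 ≤
          C * sInt μ (fun x => sInt μ (fun y => Real.exp (-d x y))) := by
  refine ⟨Real.exp M, Real.exp_pos M, fun μ hμ => ?_⟩
  have hce : Continuous (Function.uncurry fun x y => Real.exp (-d x y)) :=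
    Real.continuous_exp.comp hd.neg
  have h := sInt_sInt_nonneg hA hAne hM.exp_sub
    (by exact hce.sub continuous_const) μ hμ
  have hb : ∀ x y, |Real.exp (-d x y)| ≤ 1 := fun x y => by
    rw [abs_of_pos (Real.exp_pos _), Real.exp_le_one_iff]; linarith [hd0 x y]
  have e1 : ∀ x, sInt μ (fun y => Real.exp (-d x y) - Real.exp (-M))
      = sInt μ (fun y => Real.exp (-d x y)) - Real.exp (-M) * μ Set.univ := fun x =>
    sInt_sub_const μ _ _ 1 (hce.measurable.comp measurable_prodMk_left) (hb x)
  simp_rw [e1] at h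
  rw [sInt_sub_const μ _ _ _ (measurable_sInt μ hce.measurable)
    (fun x => abs_sInt_le μ (hb x))] at h
  have h2 := mul_nonneg (Real.exp_pos M).le h
  rw [mul_sub, mul_assoc, ← mul_assoc (Real.exp M) (Real.exp (-M)), ← Real.exp_add] at h2
  simp only [add_neg_cancel, Real.exp_zero, one_mul] at h2
  rw [sq]
  linarith

theorem psd_base {E : Type} {S : Set E} (f : E → ℝ) {L : ℝ} (hL : ∀ x ∈ S, |f x| ≤ L) :
    PSDK S (fun x y => L - |f x - f y|) := by
  have hstep : ∀ a b : ℝ, -L ≤ a → a ≤ b → b ≤ L →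
      ∫ z in Set.Ioc (-L) L, (if z ≤ a then (1 : ℝ) else -1) * (if z ≤ b then (1 : ℝ) else -1)
        = 2 * (L - (b - a)) := by
    intro a b ha hab hb
    have e : ∀ z : ℝ, (if z ≤ a then (1 : ℝ) else -1) * (if z ≤ b then (1 : ℝ) else -1)
        = 1 - (Set.Ioc a b).indicator (fun _ => (2 : ℝ)) z := by
      intro z
      by_cases h1 : z ≤ a
      · have h2 : z ≤ b := h1.trans hab
        have h3 : z ∉ Set.Ioc a b := fun h => absurd h.1 (not_lt.2 h1)
        simp [h1, h2, h3]
      · by_cases h2 : z ≤ b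
        · have h3 : z ∈ Set.Ioc a b := ⟨not_le.1 h1, h2⟩
          simp [h1, h2, h3]; norm_num
        · have h3 : z ∉ Set.Ioc a b := fun h => h2 h.2
          simp [h1, h2, h3]
    simp_rw [e]
    rw [integral_sub (integrable_const _)
      ((integrable_const _).indicator measurableSet_Ioc),
      setIntegral_indicator measurableSet_Ioc,
      Set.inter_eq_self_of_subset_right (Set.Ioc_subset_Ioc ha hb)]
    simp [Real.volume_real_Ioc_of_le hab, Real.volume_real_Ioc_of_le (by linarith : -L ≤ L)]
    ring
  have hmeas : ∀ a : ℝ, Measurable (fun z : ℝ => if z ≤ a then (1 : ℝ) else -1) := fun a =>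
    Measurable.ite measurableSet_Iic measurable_const measurable_const
  have key : PSDK S (fun x y => ∫ z in Set.Ioc (-L) L,
      (if z ≤ f x then (1 : ℝ) else -1) * (if z ≤ f y then (1 : ℝ) else -1)) := by
    refine PSDK.integral _ (Filter.Eventually.of_forall fun z => PSDK.rankOne _) ?_
    intro x _ y _
    refine (integrable_const (1 : ℝ)).mono' ((hmeas _).mul (hmeas _)).aestronglyMeasurable ?_
    refine Filter.Eventually.of_forall fun z => ?_
    split_ifs <;> simp
  refine (key.smul (a := 1 / 2) (by norm_num)).congr' fun x hx y hy => ?_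
  have hx' := abs_le.1 (hL x hx)
  have hy' := abs_le.1 (hL y hy)
  rcases le_total (f x) (f y) with h | h
  · rw [hstep _ _ hx'.1 h hy'.2, abs_of_nonpos (by linarith)]; ring
  · have := hstep _ _ hy'.1 h hx'.2
    simp_rw [mul_comm (if _ ≤ f y then (1 : ℝ) else -1)] at this
    rw [this, abs_of_nonneg (by linarith)]; ring

section Ints

theorem int_bound {D r q : ℝ} (hq : 0 < q) (hqr : q < r) (hD : 0 ≤ D) :
    IntegrableOn (fun u : ℝ => min 2 (D * u ^ r) * u ^ (-1 - q)) (Set.Ioi 0) := by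
  have hm : Measurable (fun u : ℝ => min 2 (D * u ^ r) * u ^ (-1 - q)) := by fun_prop
  rw [← Set.Ioc_union_Ioi_eq_Ioi zero_le_one]
  refine IntegrableOn.union ?_ ?_
  · have h1 : IntegrableOn (fun u : ℝ => D * u ^ (r - 1 - q)) (Set.Ioc 0 1) := by
      refine Integrable.const_mul ?_ _
      have := intervalIntegral.intervalIntegrable_rpow' (a := 0) (b := 1) (r := r - 1 - q)
        (by linarith)
      exact (intervalIntegrable_iff_integrableOn_Ioc_of_le zero_le_one).1 this
    refine Integrable.mono' h1 hm.aestronglyMeasurable ?_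
    refine (ae_restrict_iff' measurableSet_Ioc).2 (Filter.Eventually.of_forall fun u hu => ?_)
    have hu0 : 0 < u := hu.1
    rw [Real.norm_of_nonneg (by positivity)]
    have : D * u ^ (r - 1 - q) = D * u ^ r * u ^ (-1 - q) := by
      rw [mul_assoc, ← Real.rpow_add hu0]; ring_nf
    rw [this]
    gcongr
    exact min_le_right _ _
  · have h1 : IntegrableOn (fun u : ℝ => 2 * u ^ (-1 - q)) (Set.Ioi 1) :=
      Integrable.const_mul (integrableOn_Ioi_rpow_of_lt (by linarith) one_pos) _
    refine Integrable.mono' h1 hm.aestronglyMeasurable ?_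
    refine (ae_restrict_iff' measurableSet_Ioi).2 (Filter.Eventually.of_forall fun u hu => ?_)
    have hu0 : (0 : ℝ) < u := lt_trans one_pos hu
    rw [Real.norm_of_nonneg (by positivity)]
    gcongr
    exact min_le_left _ _

theorem int_of_bound {h : ℝ → ℝ} {D r q : ℝ} (hq : 0 < q) (hqr : q < r) (hD : 0 ≤ D)
    (hm : Measurable h) (h1 : ∀ u, 0 < u → |h u| ≤ 2) (h2 : ∀ u, 0 < u → |h u| ≤ D * u ^ r) :
    IntegrableOn (fun u : ℝ => h u * u ^ (-1 - q)) (Set.Ioi 0) := by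
  refine Integrable.mono' (int_bound hq hqr hD) (by fun_prop) ?_
  refine (ae_restrict_iff' measurableSet_Ioi).2 (Filter.Eventually.of_forall fun u hu => ?_)
  have hu0 : (0 : ℝ) < u := hu
  rw [norm_mul, Real.norm_of_nonneg (Real.rpow_nonneg hu0.le _)]
  gcongr
  exact le_min (h1 u hu0) (h2 u hu0)

theorem int_scale (h : ℝ → ℝ) {b q : ℝ} (hb : 0 < b) :
    ∫ u in Set.Ioi (0 : ℝ), h (u * b) * u ^ (-1 - q)
      = b ^ q * ∫ u in Set.Ioi (0 : ℝ), h u * u ^ (-1 - q) := by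
  have h1 : ∫ u in Set.Ioi (0 : ℝ), h (u * b) * u ^ (-1 - q)
      = ∫ u in Set.Ioi (0 : ℝ), b ^ (1 + q) * (h (u * b) * (u * b) ^ (-1 - q)) := by
    refine setIntegral_congr_fun measurableSet_Ioi fun u hu => ?_
    have hu0 : (0 : ℝ) < u := hu
    have : b ^ (1 + q) * b ^ (-1 - q) = 1 := by
      rw [← Real.rpow_add hb]; ring_nf; simp
    rw [Real.mul_rpow hu0.le hb.le]
    linear_combination -(h (u * b) * u ^ (-1 - q)) * this
  rw [h1, integral_const_mul,
    integral_comp_mul_right_Ioi (fun v => h v * v ^ (-1 - q)) 0 hb, zero_mul, smul_eq_mul,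
    ← mul_assoc, Real.rpow_add hb, Real.rpow_one]
  field_simp

theorem int_pos {h : ℝ → ℝ} {q : ℝ} (h0 : ∀ u, 0 < u → 0 ≤ h u)
    (h1 : ∀ u, 0 < u → u < 1 → 0 < h u)
    (hi : IntegrableOn (fun u : ℝ => h u * u ^ (-1 - q)) (Set.Ioi 0)) :
    0 < ∫ u in Set.Ioi (0 : ℝ), h u * u ^ (-1 - q) := by
  rw [setIntegral_pos_iff_support_of_nonneg_ae ?_ hi]
  · have : Set.Ioo (0 : ℝ) 1 ⊆ Function.support (fun u : ℝ => h u * u ^ (-1 - q)) ∩ Set.Ioi 0 := by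
      intro u hu
      exact ⟨(mul_pos (h1 u hu.1 hu.2) (Real.rpow_pos_of_pos hu.1 _)).ne', hu.1⟩
    refine lt_of_lt_of_le ?_ (measure_mono this)
    simp
  · refine (ae_restrict_iff' measurableSet_Ioi).2 (Filter.Eventually.of_forall fun u hu => ?_)
    exact mul_nonneg (h0 u hu) (Real.rpow_nonneg (le_of_lt hu) _)

theorem one_sub_cos_le (u : ℝ) : 1 - Real.cos u ≤ u ^ 2 / 2 := by
  linarith [Real.one_sub_sq_div_two_le_cos (x := u)]

theorem int_cos {q : ℝ} (hq : 0 < q) (hq2 : q < 2) (z : ℝ) :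
    IntegrableOn (fun u : ℝ => (1 - Real.cos (u * z)) * u ^ (-1 - q)) (Set.Ioi 0) := by
  refine int_of_bound (h := fun u => 1 - Real.cos (u * z)) (r := 2) (D := z ^ 2 / 2) hq hq2
    (by positivity) (by fun_prop) ?_ ?_
  · intro u _
    rw [abs_le]; constructor <;> linarith [Real.cos_le_one (u * z), Real.neg_one_le_cos (u * z)]
  · intro u _
    rw [abs_of_nonneg (by linarith [Real.cos_le_one (u * z)])]
    have := one_sub_cos_le (u * z)
    rw [Real.rpow_two]
    linarith [mul_pow u z 2]

/-- The constant `∫ (1 - cos u) u^{-1-q}`. -/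
noncomputable def kap (q : ℝ) : ℝ := ∫ u in Set.Ioi (0 : ℝ), (1 - Real.cos u) * u ^ (-1 - q)

theorem kap_pos {q : ℝ} (hq : 0 < q) (hq2 : q < 2) : 0 < kap q := by
  refine int_pos (h := fun u => 1 - Real.cos u)
    (fun u _ => by linarith [Real.cos_le_one u]) ?_ (by simpa using int_cos hq hq2 1)
  intro u hu hu1
  have := Real.cos_lt_cos_of_nonneg_of_le_pi le_rfl (by linarith [Real.pi_gt_three]) hu
  rw [Real.cos_zero] at this
  linarith

theorem int_cos_eq {q : ℝ} (hq : 0 < q) (z : ℝ) :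
    ∫ u in Set.Ioi (0 : ℝ), (1 - Real.cos (u * z)) * u ^ (-1 - q) = |z| ^ q * kap q := by
  rcases eq_or_ne z 0 with rfl | hz
  · simp [Real.zero_rpow hq.ne']
  · rw [kap, ← int_scale (fun u => 1 - Real.cos u) (abs_pos.2 hz)]
    refine setIntegral_congr_fun measurableSet_Ioi fun u hu => ?_
    have hu0 : (0 : ℝ) < u := hu
    rw [← Real.cos_abs (u * z), abs_mul, abs_of_pos hu0]

end Ints

section Laws

/-- A law whose cosine transform behaves like `1 - c |u|^p` near zero. -/
def GoodLaw (p : ℝ) (P : Measure ℝ) (c : ℝ) : Prop :=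
  IsProbabilityMeasure P ∧ Integrable (fun y : ℝ => y) P ∧ 0 < c ∧
  (∃ D : ℝ, 0 ≤ D ∧ ∀ u : ℝ, 1 - ∫ y, Real.cos (u * y) ∂P ≤ D * |u| ^ p) ∧
  Filter.Tendsto (fun u : ℝ => (1 - ∫ y, Real.cos (u * y) ∂P) / |u| ^ p)
    (nhdsWithin 0 {0}ᶜ) (nhds c)

theorem goodLaw_two : GoodLaw 2 (Measure.dirac 1) (1 / 2) := by
  refine ⟨inferInstance, integrable_dirac (by simp), by norm_num, ⟨1 / 2, by norm_num, ?_⟩, ?_⟩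
  · intro u
    simp only [integral_dirac, mul_one, Real.rpow_two, sq_abs]
    linarith [one_sub_cos_le u]
  · simp only [integral_dirac, mul_one, Real.rpow_two, sq_abs]
    refine tendsto_of_tendsto_of_tendsto_of_le_of_le'
      (g := fun u : ℝ => 1 / 2 - u ^ 2 * (5 / 96)) (h := fun _ => 1 / 2) ?_ tendsto_const_nhds ?_ ?_
    · have : Continuous (fun u : ℝ => 1 / 2 - u ^ 2 * (5 / 96)) := by fun_prop
      have h := this.tendsto 0
      simp only [ne_eq, OfNat.ofNat_ne_zero, not_false_eq_true, zero_pow, zero_mul, sub_zero] at h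
      exact h.mono_left nhdsWithin_le_nhds
    · have h1 : ∀ᶠ u : ℝ in nhds 0, |u| < 1 := by
        have : Continuous (fun u : ℝ => |u|) := continuous_abs
        exact this.tendsto' 0 0 (by simp) |>.eventually (gt_mem_nhds one_pos)
      filter_upwards [nhdsWithin_le_nhds h1, self_mem_nhdsWithin] with u hu hu0
      have hu0' : u ≠ 0 := hu0
      rw [le_div_iff₀ (by positivity)]
      have := (abs_le.1 (Real.cos_bound hu.le)).2
      have e : |u| ^ 4 = u ^ 2 * u ^ 2 := by rw [← sq_abs]; ring
      rw [e] at this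
      nlinarith
    · filter_upwards [self_mem_nhdsWithin] with u hu0
      have hu0' : u ≠ 0 := hu0
      rw [div_le_iff₀ (by positivity)]
      linarith [one_sub_cos_le u]

/-- The Pareto law. -/
noncomputable def parLaw (p : ℝ) : Measure ℝ :=
  (volume.restrict (Set.Ioi 1)).withDensity (fun y => ENNReal.ofReal (p * y ^ (-1 - p)))

theorem integral_parLaw {p : ℝ} (hp : 0 < p) (f : ℝ → ℝ) :
    ∫ y, f y ∂(parLaw p) = ∫ y in Set.Ioi (1 : ℝ), p * (f y * y ^ (-1 - p)) := by
  unfold parLaw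
  rw [integral_withDensity_eq_integral_toReal_smul (by fun_prop) (by simp)]
  refine setIntegral_congr_fun measurableSet_Ioi fun y hy => ?_
  have hy0 : (0 : ℝ) < y := lt_trans one_pos hy
  rw [ENNReal.toReal_ofReal (by positivity), smul_eq_mul]
  ring

theorem parLaw_prob {p : ℝ} (hp : 0 < p) : IsProbabilityMeasure (parLaw p) := by
  constructor
  unfold parLaw
  rw [withDensity_apply _ MeasurableSet.univ, Measure.restrict_univ,
    ← ofReal_integral_eq_lintegral_ofReal]
  · rw [integral_const_mul, integral_Ioi_rpow_of_lt (by linarith) one_pos]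
    have : -1 - p + 1 = -p := by ring
    rw [this, Real.one_rpow]
    field_simp
    simp
  · exact (integrableOn_Ioi_rpow_of_lt (by linarith) one_pos).const_mul _
  · refine (ae_restrict_iff' measurableSet_Ioi).2 (Filter.Eventually.of_forall fun y hy => ?_)
    have hy0 : (0 : ℝ) < y := lt_trans one_pos hy
    simp only [Pi.zero_apply]
    positivity

theorem goodLaw_par {p : ℝ} (hp : 1 < p) (hp2 : p < 2) :
    GoodLaw p (parLaw p) (p * kap p) := by
  have hp0 : 0 < p := by linarith
  have := parLaw_prob hp0
  have hic : ∀ u : ℝ, Integrable (fun y => Real.cos (u * y)) (parLaw p) := fun u =>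
    (integrable_const (1 : ℝ)).mono' (by fun_prop)
      (Filter.Eventually.of_forall fun y => Real.abs_cos_le_one _)
  have e1 : ∀ u : ℝ, 1 - ∫ y, Real.cos (u * y) ∂(parLaw p)
      = p * ∫ y in Set.Ioi (1 : ℝ), (1 - Real.cos (y * u)) * y ^ (-1 - p) := by
    intro u
    have : 1 - ∫ y, Real.cos (u * y) ∂(parLaw p) = ∫ y, (1 - Real.cos (y * u)) ∂(parLaw p) := by
      simp_rw [mul_comm _ u]
      rw [integral_sub (integrable_const _) (hic u)]
      simp
    rw [this, integral_parLaw hp0, integral_const_mul]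
  have e2 : ∀ u : ℝ, ∫ y in Set.Ioi (1 : ℝ), (1 - Real.cos (y * u)) * y ^ (-1 - p)
      = |u| ^ p * kap p - ∫ y in Set.Ioc (0 : ℝ) 1, (1 - Real.cos (y * u)) * y ^ (-1 - p) := by
    intro u
    have hI := int_cos hp0 hp2 u
    rw [← int_cos_eq hp0 u, ← Set.Ioc_union_Ioi_eq_Ioi zero_le_one, setIntegral_union
      Set.Ioc_disjoint_Ioi_same measurableSet_Ioi
      (hI.mono_set Set.Ioc_subset_Ioi_self) (hI.mono_set (Set.Ioi_subset_Ioi zero_le_one))]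
    ring
  have e3 : ∀ u : ℝ, 0 ≤ ∫ y in Set.Ioc (0 : ℝ) 1, (1 - Real.cos (y * u)) * y ^ (-1 - p) := by
    intro u
    refine setIntegral_nonneg measurableSet_Ioc fun y hy => ?_
    exact mul_nonneg (by linarith [Real.cos_le_one (y * u)]) (Real.rpow_nonneg hy.1.le _)
  have e4 : ∃ K : ℝ, ∀ u : ℝ, ∫ y in Set.Ioc (0 : ℝ) 1, (1 - Real.cos (y * u)) * y ^ (-1 - p)
      ≤ K * u ^ 2 := by
    refine ⟨(∫ y in Set.Ioc (0 : ℝ) 1, y ^ (1 - p)) / 2, fun u => ?_⟩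
    have h1 : IntegrableOn (fun y : ℝ => y ^ (1 - p)) (Set.Ioc 0 1) :=
      (intervalIntegrable_iff_integrableOn_Ioc_of_le zero_le_one).1
        (intervalIntegral.intervalIntegrable_rpow' (by linarith))
    have : (∫ y in Set.Ioc (0 : ℝ) 1, y ^ (1 - p)) / 2 * u ^ 2
        = ∫ y in Set.Ioc (0 : ℝ) 1, y ^ (1 - p) * (u ^ 2 / 2) := by
      rw [integral_mul_const]; ring
    rw [this]
    refine setIntegral_mono_on ((int_cos hp0 hp2 u).mono_set Set.Ioc_subset_Ioi_self)
      (h1.mul_const _) measurableSet_Ioc fun y hy => ?_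
    have hy0 : 0 < y := hy.1
    have e : y ^ (1 - p) = y ^ 2 * y ^ (-1 - p) := by
      rw [← Real.rpow_two, ← Real.rpow_add hy0]; ring_nf
    have h2 := mul_le_mul_of_nonneg_right (one_sub_cos_le (y * u))
      (Real.rpow_nonneg hy0.le (-1 - p))
    rw [e]
    refine h2.trans_eq ?_
    ring
  refine ⟨this, ?_, mul_pos hp0 (kap_pos hp0 hp2), ⟨p * kap p,
    (mul_pos hp0 (kap_pos hp0 hp2)).le, ?_⟩, ?_⟩
  · unfold parLaw
    rw [integrable_withDensity_iff (by fun_prop) (by simp)]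
    have : IntegrableOn (fun y : ℝ => p * y ^ (-p)) (Set.Ioi 1) :=
      (integrableOn_Ioi_rpow_of_lt (by linarith) one_pos).const_mul _
    refine this.congr_fun (fun y hy => ?_) measurableSet_Ioi
    have hy0 : (0 : ℝ) < y := lt_trans one_pos hy
    simp only
    rw [ENNReal.toReal_ofReal (by positivity)]
    have : y ^ (-p) = y * y ^ (-1 - p) := by
      nth_rewrite 2 [← Real.rpow_one y]
      rw [← Real.rpow_add hy0]; ring_nf
    rw [this]; ring
  · intro u
    rw [e1, e2]
    nlinarith [e3 u]
  · obtain ⟨K, hK⟩ := e4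
    refine tendsto_of_tendsto_of_tendsto_of_le_of_le'
      (g := fun u : ℝ => p * kap p - p * K * |u| ^ (2 - p)) (h := fun _ => p * kap p) ?_
      tendsto_const_nhds ?_ ?_
    · have : Continuous (fun u : ℝ => p * kap p - p * K * |u| ^ (2 - p)) := by
        refine continuous_const.sub (continuous_const.mul ?_)
        exact continuous_abs.rpow_const fun _ => Or.inr (by linarith)
      have h := this.tendsto 0
      simp only [abs_zero, Real.zero_rpow (by linarith : (2 - p) ≠ 0), mul_zero, sub_zero] at h
      exact h.mono_left nhdsWithin_le_nhds
    · filter_upwards [self_mem_nhdsWithin] with u hu0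
      have hu0' : 0 < |u| := abs_pos.2 hu0
      rw [le_div_iff₀ (by positivity), e1, e2, sub_mul, mul_assoc (p * K), ← Real.rpow_add hu0']
      have : |u| ^ (2 - p + p) = u ^ 2 := by
        rw [sub_add_cancel, Real.rpow_two, sq_abs]
      rw [this]
      nlinarith [hK u]
    · filter_upwards [self_mem_nhdsWithin] with u hu0
      have hu0' : 0 < |u| := abs_pos.2 hu0
      rw [div_le_iff₀ (by positivity), e1, e2]
      nlinarith [e3 u]

theorem exists_goodLaw {p : ℝ} (hp : 1 < p) (hp2 : p ≤ 2) : ∃ P c, GoodLaw p P c := by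
  rcases hp2.eq_or_lt with rfl | h
  · exact ⟨_, _, goodLaw_two⟩
  · exact ⟨_, _, goodLaw_par hp h⟩

end Laws

section Stable

/-- Symmetrization of a law. -/
noncomputable def symLaw (P : Measure ℝ) : Measure ℝ :=
  (2⁻¹ : ENNReal) • P + (2⁻¹ : ENNReal) • P.map (fun y => -y)

theorem symLaw_prob (P : Measure ℝ) [IsProbabilityMeasure P] :
    IsProbabilityMeasure (symLaw P) := by
  constructor
  unfold symLaw
  have : IsProbabilityMeasure (P.map (fun y => -y)) :=
    Measure.isProbabilityMeasure_map (by fun_prop)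
  simp [ENNReal.inv_two_add_inv_two]

theorem integrable_symLaw {F : Type*} [NormedAddCommGroup F] {P : Measure ℝ} {f : ℝ → F}
    (h1 : Integrable f P) (h2 : Integrable (fun y => f (-y)) P) :
    Integrable f (symLaw P) := by
  unfold symLaw
  refine (h1.smul_measure (by simp)).add_measure (Integrable.smul_measure ?_ (by simp))
  exact ((MeasurableEquiv.neg ℝ).measurableEmbedding.integrable_map_iff).2 h2

theorem charFun_symLaw (P : Measure ℝ) [IsProbabilityMeasure P] (u : ℝ) :
    ∫ y, Complex.exp (((u * y : ℝ) : ℂ) * Complex.I) ∂(symLaw P)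
      = ((∫ y, Real.cos (u * y) ∂P : ℝ) : ℂ) := by
  have hb : ∀ v : ℝ, Integrable (fun y : ℝ => Complex.exp (((v * y : ℝ) : ℂ) * Complex.I)) P :=
    fun v => (integrable_const (1 : ℝ)).mono' (by fun_prop)
      (Filter.Eventually.of_forall fun y => (Complex.norm_exp_ofReal_mul_I _).le)
  have e : ∀ y : ℝ, Complex.exp (((u * -y : ℝ) : ℂ) * Complex.I)
      = Complex.exp (((-u * y : ℝ) : ℂ) * Complex.I) := by
    intro y; congr 3; ring
  have hb2 : Integrable (fun y : ℝ => Complex.exp (((u * -y : ℝ) : ℂ) * Complex.I)) P := by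
    simp_rw [e]; exact hb (-u)
  have hmap : Integrable (fun y : ℝ => Complex.exp (((u * y : ℝ) : ℂ) * Complex.I))
      (P.map (fun y => -y)) :=
    ((MeasurableEquiv.neg ℝ).measurableEmbedding.integrable_map_iff).2 hb2
  unfold symLaw
  rw [integral_add_measure ((hb u).smul_measure (by simp)) (hmap.smul_measure (by simp)),
    integral_smul_measure, integral_smul_measure, integral_map (by fun_prop) (by fun_prop),
    ← smul_add, ← integral_add (hb u) hb2, ← integral_complex_ofReal, ← integral_smul]
  congr 1
  ext y
  rw [Complex.ofReal_cos, Complex.cos]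
  have : (((u * -y : ℝ) : ℂ) * Complex.I) = -((u * y : ℝ) : ℂ) * Complex.I := by push_cast; ring
  rw [this]
  simp
  ring

theorem expect_abs {K : Type} [Fintype K] (ρ : Measure ℝ) [IsProbabilityMeasure ρ]
    (hintg : Integrable (fun y : ℝ => y) ρ) (ψ : ℝ → ℝ)
    (hψ : ∀ u : ℝ, ∫ y, Complex.exp (((u * y : ℝ) : ℂ) * Complex.I) ∂ρ = ((ψ u : ℝ) : ℂ))
    (a : K → ℝ) :
    Integrable (fun y : K → ℝ => |∑ k, a k * y k|) (Measure.pi fun _ => ρ) ∧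
    kap 1 * ∫ y, |∑ k, a k * y k| ∂(Measure.pi fun _ : K => ρ)
      = ∫ u in Set.Ioi (0 : ℝ), (1 - ∏ k, ψ (u * a k)) * u ^ (-1 - 1 : ℝ) := by
  have hI : Integrable (fun y : K → ℝ => |∑ k, a k * y k|) (Measure.pi fun _ => ρ) := by
    refine Integrable.abs (integrable_finsetSum _ fun k _ => Integrable.const_mul ?_ _)
    exact integrable_comp_eval (μ := fun _ : K => ρ) (i := k) hintg
  refine ⟨hI, ?_⟩
  have hprod : ∀ u : ℝ, ∫ y, (1 - Real.cos (u * ∑ k, a k * y k)) ∂(Measure.pi fun _ : K => ρ)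
      = 1 - ∏ k, ψ (u * a k) := by
    intro u
    have hc : ∫ y, Complex.exp (((u * ∑ k, a k * y k : ℝ) : ℂ) * Complex.I)
        ∂(Measure.pi fun _ : K => ρ) = ((∏ k, ψ (u * a k) : ℝ) : ℂ) := by
      have e : ∀ y : K → ℝ, Complex.exp (((u * ∑ k, a k * y k : ℝ) : ℂ) * Complex.I)
          = ∏ k, Complex.exp ((((u * a k) * y k : ℝ) : ℂ) * Complex.I) := by
        intro y
        rw [← Complex.exp_sum]
        congr 1
        push_cast
        rw [Finset.mul_sum, Finset.sum_mul]
        refine Finset.sum_congr rfl fun k _ => by ring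
      simp_rw [e]
      rw [integral_fintype_prod_eq_prod (μ := fun _ : K => ρ)
        (fun k (x : ℝ) => Complex.exp ((((u * a k) * x : ℝ) : ℂ) * Complex.I))]
      simp_rw [hψ]
      push_cast
      rfl
    have hci : Integrable (fun y : K → ℝ =>
        Complex.exp (((u * ∑ k, a k * y k : ℝ) : ℂ) * Complex.I)) (Measure.pi fun _ => ρ) :=
      (integrable_const (1 : ℝ)).mono' (Continuous.aestronglyMeasurable (by fun_prop))
        (Filter.Eventually.of_forall fun y => (Complex.norm_exp_ofReal_mul_I _).le)
    have hre : ∫ y, Real.cos (u * ∑ k, a k * y k) ∂(Measure.pi fun _ : K => ρ)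
        = ∏ k, ψ (u * a k) := by
      have h := congrArg Complex.re hc
      rw [Complex.ofReal_re] at h
      rw [← h]
      have h2 := integral_re (𝕜 := ℂ) hci
      simp only [RCLike.re_eq_complex_re, Complex.exp_ofReal_mul_I_re] at h2
      exact h2
    rw [integral_sub (integrable_const _), hre]
    · simp
    · exact (integrable_const (1 : ℝ)).mono' (Continuous.aestronglyMeasurable (by fun_prop))
        (Filter.Eventually.of_forall fun y => Real.abs_cos_le_one _)
  have hinner : ∀ y : K → ℝ, kap 1 * |∑ k, a k * y k|
      = ∫ u in Set.Ioi (0 : ℝ), (1 - Real.cos (u * ∑ k, a k * y k)) * u ^ (-1 - 1 : ℝ) := by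
    intro y
    rw [int_cos_eq one_pos, Real.rpow_one, mul_comm]
  rw [← integral_const_mul]
  simp_rw [hinner]
  rw [integral_integral_swap]
  · refine setIntegral_congr_fun measurableSet_Ioi fun u hu => ?_
    rw [integral_mul_const, hprod]
  · rw [integrable_prod_iff (by
      refine Measurable.aestronglyMeasurable ?_
      simp only [Function.uncurry_def]
      fun_prop)]
    refine ⟨Filter.Eventually.of_forall fun y => ?_, ?_⟩
    · have := int_cos one_pos one_lt_two (∑ k, a k * y k)
      exact this
    refine (hI.const_mul (kap 1)).congr (Filter.Eventually.of_forall fun y => ?_)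
    simp only
    rw [hinner]
    refine setIntegral_congr_fun measurableSet_Ioi fun u hu => ?_
    have hu0 : (0 : ℝ) < u := hu
    simp only [Function.uncurry]
    rw [Real.norm_of_nonneg]
    exact mul_nonneg (by linarith [Real.cos_le_one (u * ∑ k, a k * y k)])
      (Real.rpow_nonneg hu0.le _)

theorem abs_one_sub_prod_le {K : Type} (s : Finset K) (a : K → ℝ) (h : ∀ k, |a k| ≤ 1) :
    |∏ k ∈ s, a k| ≤ 1 ∧ |1 - ∏ k ∈ s, a k| ≤ ∑ k ∈ s, |1 - a k| := by
  classical
  induction s using Finset.induction_on with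
  | empty => simp
  | insert b s hb ih =>
    rw [Finset.prod_insert hb, Finset.sum_insert hb]
    refine ⟨?_, ?_⟩
    · rw [abs_mul]
      exact mul_le_one₀ (h b) (abs_nonneg _) ih.1
    · have e : 1 - a b * ∏ k ∈ s, a k = (1 - a b) + a b * (1 - ∏ k ∈ s, a k) := by ring
      rw [e]
      refine (abs_add_le _ _).trans ?_
      rw [abs_mul]
      have := mul_le_mul (h b) ih.2 (abs_nonneg _) zero_le_one
      linarith

end Stable

section Limit

theorem pow_tendsto_exp {p c : ℝ} (hp : 0 < p) {ψ : ℝ → ℝ} (hψ0 : ψ 0 = 1)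
    (hψ : Filter.Tendsto (fun u : ℝ => (1 - ψ u) / |u| ^ p) (nhdsWithin 0 {0}ᶜ) (nhds c))
    (v : ℝ) :
    Filter.Tendsto (fun N : ℕ => ψ (v * (N : ℝ) ^ (-1 / p)) ^ N) Filter.atTop
      (nhds (Real.exp (-(c * |v| ^ p)))) := by
  rcases eq_or_ne v 0 with rfl | hv
  · simp [hψ0, Real.zero_rpow hp.ne']
  have hδ : Filter.Tendsto (fun N : ℕ => v * (N : ℝ) ^ (-1 / p)) Filter.atTop (nhds 0) := by
    have h1 := (tendsto_rpow_neg_atTop (y := 1 / p) (by positivity)).comp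
      (tendsto_natCast_atTop_atTop (R := ℝ))
    have h2 := h1.const_mul v
    rw [mul_zero] at h2
    refine h2.congr fun N => ?_
    simp only [Function.comp]
    rw [neg_div]
  have hδ' : Filter.Tendsto (fun N : ℕ => v * (N : ℝ) ^ (-1 / p)) Filter.atTop
      (nhdsWithin 0 {0}ᶜ) := by
    refine tendsto_nhdsWithin_iff.2 ⟨hδ, ?_⟩
    filter_upwards [Filter.eventually_gt_atTop 0] with N hN
    have : (0 : ℝ) < N := by exact_mod_cast hN
    exact mul_ne_zero hv (by positivity)
  have h := ((hψ.comp hδ').mul_const (|v| ^ p)).neg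
  have h2 := Real.tendsto_one_add_pow_exp_of_tendsto
    (g := fun N : ℕ => ψ (v * (N : ℝ) ^ (-1 / p)) - 1) (t := -(c * |v| ^ p)) (by
      refine h.congr' ?_
      filter_upwards [Filter.eventually_gt_atTop 0] with N hN
      have hN' : (0 : ℝ) < N := by exact_mod_cast hN
      have e : |v * (N : ℝ) ^ (-1 / p)| ^ p = |v| ^ p * (N : ℝ)⁻¹ := by
        rw [abs_mul, abs_of_pos (by positivity : (0 : ℝ) < (N : ℝ) ^ (-1 / p)),
          Real.mul_rpow (abs_nonneg _) (by positivity), ← Real.rpow_mul hN'.le,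
          div_mul_cancel₀ _ hp.ne', Real.rpow_neg_one]
      have hv' : |v| ^ p ≠ 0 := (Real.rpow_pos_of_pos (abs_pos.2 hv) p).ne'
      simp only [Function.comp]
      rw [e]
      field_simp
      ring)
  simpa using h2

/-- The expected absolute value of a normalized sum. -/
noncomputable def Fexp (p : ℝ) (ρ : Measure ℝ) (N : ℕ) {n : ℕ} (t : Fin n → ℝ) : ℝ :=
  ∫ y, |∑ k, ((N : ℝ) ^ (-1 / p) * t k.2) * y k| ∂(Measure.pi fun _ : Fin N × Fin n => ρ)

/-- The limit constant. -/
noncomputable def Gc (p c : ℝ) : ℝ :=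
  ∫ u in Set.Ioi (0 : ℝ), (1 - Real.exp (-(c * |u| ^ p))) * u ^ (-1 - 1 : ℝ)

theorem Gc_pos {p c : ℝ} (hp : 1 < p) (hc : 0 < c) : 0 < Gc p c := by
  have h1 : ∀ u : ℝ, 0 ≤ 1 - Real.exp (-(c * |u| ^ p)) := fun u => by
    have : Real.exp (-(c * |u| ^ p)) ≤ 1 := Real.exp_le_one_iff.2 (by
      have : 0 ≤ c * |u| ^ p := by positivity
      linarith)
    linarith
  refine int_pos (h := fun u => 1 - Real.exp (-(c * |u| ^ p))) (fun u _ => h1 u) ?_ ?_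
  · intro u hu _
    have : Real.exp (-(c * |u| ^ p)) < 1 := Real.exp_lt_one_iff.2 (by
      have : 0 < c * |u| ^ p := mul_pos hc (Real.rpow_pos_of_pos (abs_pos.2 hu.ne') _)
      linarith)
    linarith
  · refine int_of_bound (h := fun u => 1 - Real.exp (-(c * |u| ^ p))) one_pos hp hc.le
      (by fun_prop) ?_ ?_
    · intro u _
      rw [abs_of_nonneg (h1 u)]
      linarith [Real.exp_pos (-(c * |u| ^ p))]
    · intro u hu
      rw [abs_of_nonneg (h1 u)]
      have := Real.add_one_le_exp (-(c * |u| ^ p))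
      rw [abs_of_pos hu] at this ⊢
      linarith

theorem Fexp_tendsto {p c : ℝ} (hp : 1 < p) {P : Measure ℝ} (hP : GoodLaw p P c)
    {n : ℕ} (t : Fin n → ℝ) :
    Filter.Tendsto (fun N : ℕ => kap 1 * Fexp p (symLaw P) N t) Filter.atTop
      (nhds (Gc p c * (∑ j, |t j| ^ p) ^ (1 / p))) := by
  have hp0 : 0 < p := by linarith
  obtain ⟨hprob, hintg, hc, ⟨D, hD0, hD⟩, hlim⟩ := hP
  have := symLaw_prob P
  set ψ : ℝ → ℝ := fun u => ∫ y, Real.cos (u * y) ∂P with hψ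
  have hψ0 : ψ 0 = 1 := by simp [hψ]
  have hψ1 : ∀ u, |ψ u| ≤ 1 := fun u => by
    have h := norm_integral_le_of_norm_le_const (μ := P) (f := fun y => Real.cos (u * y)) (C := 1)
      (Filter.Eventually.of_forall fun y => Real.abs_cos_le_one _)
    simpa using h
  have hψm : Measurable ψ := by
    have : Measurable (Function.uncurry fun u y : ℝ => Real.cos (u * y)) := by
      simp only [Function.uncurry_def]; fun_prop
    exact (this.stronglyMeasurable.integral_prod_right).measurable
  have hF : ∀ N : ℕ, kap 1 * Fexp p (symLaw P) N t = ∫ u in Set.Ioi (0 : ℝ),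
      (1 - ∏ k : Fin N × Fin n, ψ (u * ((N : ℝ) ^ (-1 / p) * t k.2))) * u ^ (-1 - 1 : ℝ) :=
    fun N => (expect_abs (symLaw P) (integrable_symLaw hintg hintg.neg) ψ
      (charFun_symLaw P) _).2
  simp_rw [hF]
  set T := ∑ j, |t j| ^ p with hT
  have hT0 : 0 ≤ T := by positivity
  have hG : Gc p c * T ^ (1 / p) = ∫ u in Set.Ioi (0 : ℝ),
      (1 - ∏ j, Real.exp (-(c * |u * t j| ^ p))) * u ^ (-1 - 1 : ℝ) := by
    have e : ∀ u : ℝ, ∏ j, Real.exp (-(c * |u * t j| ^ p)) = Real.exp (-(c * (|u| ^ p * T))) := by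
      intro u
      rw [← Real.exp_sum, hT, Finset.mul_sum, Finset.mul_sum, ← Finset.sum_neg_distrib]
      congr 1
      refine Finset.sum_congr rfl fun j _ => ?_
      rw [abs_mul, Real.mul_rpow (abs_nonneg _) (abs_nonneg _)]
    simp_rw [e]
    rcases hT0.eq_or_lt with h0 | h0
    · rw [← h0, Real.zero_rpow (by positivity)]
      simp
    · have hb : 0 < T ^ (1 / p) := by positivity
      have h := int_scale (fun u => 1 - Real.exp (-(c * |u| ^ p))) (q := 1) hb
      rw [Real.rpow_one] at h
      rw [mul_comm, Gc, ← h]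
      refine setIntegral_congr_fun measurableSet_Ioi fun u hu => ?_
      rw [abs_mul, abs_of_pos hb, Real.mul_rpow (abs_nonneg _) hb.le, ← Real.rpow_mul hT0,
        one_div_mul_cancel hp0.ne', Real.rpow_one]
  rw [hG]
  refine tendsto_integral_of_dominated_convergence
    (fun u => min 2 ((D * T) * u ^ p) * u ^ (-1 - 1 : ℝ)) ?_
    (int_bound one_pos hp (by positivity)) ?_ ?_
  · intro N
    refine Measurable.aestronglyMeasurable ?_
    refine Measurable.mul (measurable_const.sub ?_) (by fun_prop)
    exact Finset.measurable_prod _ fun k _ => hψm.comp (by fun_prop)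
  · intro N
    refine (ae_restrict_iff' measurableSet_Ioi).2 (Filter.Eventually.of_forall fun u hu => ?_)
    have hu0 : (0 : ℝ) < u := hu
    rw [norm_mul, Real.norm_of_nonneg (Real.rpow_nonneg hu0.le _)]
    obtain ⟨ha, hb⟩ := abs_one_sub_prod_le (Finset.univ : Finset (Fin N × Fin n))
      (fun k => ψ (u * ((N : ℝ) ^ (-1 / p) * t k.2))) (fun k => hψ1 _)
    gcongr
    refine le_min ?_ ?_
    · have := abs_le.1 ha
      rw [Real.norm_eq_abs, abs_le]
      constructor <;> linarith [this.1, this.2]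
    · refine hb.trans ?_
      have hN1 : (N : ℝ) * ((N : ℝ) ^ (-1 / p)) ^ p ≤ 1 := by
        rcases Nat.eq_zero_or_pos N with rfl | hN
        · simp
        · have hN' : (0 : ℝ) < N := by exact_mod_cast hN
          rw [← Real.rpow_mul hN'.le, div_mul_cancel₀ _ hp0.ne', Real.rpow_neg_one,
            mul_inv_cancel₀ hN'.ne']
      have hk : ∀ k : Fin N × Fin n, |1 - ψ (u * ((N : ℝ) ^ (-1 / p) * t k.2))|
          ≤ D * u ^ p * ((N : ℝ) ^ (-1 / p)) ^ p * |t k.2| ^ p := by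
        intro k
        rw [abs_of_nonneg (by linarith [(abs_le.1 (hψ1 (u * ((N : ℝ) ^ (-1 / p) * t k.2)))).2])]
        refine (hD _).trans_eq ?_
        have hδ : 0 ≤ (N : ℝ) ^ (-1 / p) := by positivity
        rw [abs_mul, abs_mul, abs_of_pos hu0, abs_of_nonneg hδ,
          Real.mul_rpow hu0.le (by positivity), Real.mul_rpow hδ (abs_nonneg _)]
        ring
      refine (Finset.sum_le_sum fun k _ => hk k).trans ?_
      rw [← Finset.mul_sum, Fintype.sum_prod_type]
      simp only [Finset.sum_const, Finset.card_univ, Fintype.card_fin, nsmul_eq_mul]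
      rw [← hT]
      have h3 : 0 ≤ D * T * u ^ p := by positivity
      nlinarith [mul_le_mul_of_nonneg_left hN1 h3]
  · refine (ae_restrict_iff' measurableSet_Ioi).2 (Filter.Eventually.of_forall fun u hu => ?_)
    refine Filter.Tendsto.mul_const _ (Filter.Tendsto.const_sub _ ?_)
    have h := tendsto_finsetProd (Finset.univ : Finset (Fin n)) (fun j _ =>
      pow_tendsto_exp hp0 hψ0 hlim (u * t j))
    refine h.congr fun N => ?_
    rw [Fintype.prod_prod_type]
    simp only [Finset.prod_const, Finset.card_univ, Fintype.card_fin]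
    rw [← Finset.prod_pow]
    refine Finset.prod_congr rfl fun j _ => ?_
    congr 2
    ring

theorem psd_Fexp {p : ℝ} {ρ : Measure ℝ} [IsProbabilityMeasure ρ]
    (hintg : Integrable (fun y : ℝ => y) ρ) (N : ℕ) {n : ℕ} {A : Set (Fin n → ℝ)} {R : ℝ}
    (hR : ∀ x ∈ A, ∀ j, |x j| ≤ R) :
    PSDK A (fun x y => R * ∑ j, Fexp p ρ N (Pi.single j 1 : Fin n → ℝ)
      - Fexp p ρ N (fun j => x j - y j)) := by
  have hI : ∀ t : Fin n → ℝ, Integrable (fun y : Fin N × Fin n → ℝ =>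
      |∑ k, ((N : ℝ) ^ (-1 / p) * t k.2) * y k|) (Measure.pi fun _ => ρ) := by
    intro t
    refine Integrable.abs (integrable_finsetSum _ fun k _ => Integrable.const_mul ?_ _)
    exact integrable_comp_eval (μ := fun _ : Fin N × Fin n => ρ) (i := k) hintg
  have hlin : ∀ (t : Fin n → ℝ) (y : Fin N × Fin n → ℝ),
      ∑ k, ((N : ℝ) ^ (-1 / p) * t k.2) * y k
        = ∑ j, t j * ∑ i, (N : ℝ) ^ (-1 / p) * y (i, j) := by
    intro t y
    rw [Fintype.sum_prod_type_right]
    refine Finset.sum_congr rfl fun j _ => ?_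
    rw [Finset.mul_sum]
    refine Finset.sum_congr rfl fun i _ => ?_
    ring
  have hI2 : Integrable (fun y : Fin N × Fin n → ℝ => R * ∑ j,
      |∑ k, ((N : ℝ) ^ (-1 / p) * (Pi.single j 1 : Fin n → ℝ) k.2) * y k|)
      (Measure.pi fun _ => ρ) :=
    (integrable_finsetSum _ fun j _ => hI _).const_mul _
  have key : PSDK A (fun x x' => ∫ y : Fin N × Fin n → ℝ, (R * ∑ j,
      |∑ k, ((N : ℝ) ^ (-1 / p) * (Pi.single j 1 : Fin n → ℝ) k.2) * y k|
      - |∑ k, ((N : ℝ) ^ (-1 / p) * (x k.2 - x' k.2)) * y k|) ∂(Measure.pi fun _ => ρ)) := by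
    refine PSDK.integral _ (Filter.Eventually.of_forall fun y => ?_)
      (fun x _ x' _ => hI2.sub (hI fun j => x j - x' j))
    have hb := psd_base (S := A)
      (fun x => ∑ j, x j * ∑ i, (N : ℝ) ^ (-1 / p) * y (i, j))
      (L := R * ∑ j, |∑ i, (N : ℝ) ^ (-1 / p) * y (i, j)|) (by
        intro x hx
        refine (Finset.abs_sum_le_sum_abs _ _).trans ?_
        rw [Finset.mul_sum]
        refine Finset.sum_le_sum fun j _ => ?_
        rw [abs_mul]
        exact mul_le_mul_of_nonneg_right (hR x hx j) (abs_nonneg _))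
    refine hb.congr' fun x _ x' _ => ?_
    have e1 := hlin (fun j => x j - x' j) y
    rw [e1]
    simp_rw [hlin _ y]
    congr 2
    · refine Finset.sum_congr rfl fun j _ => ?_
      congr 1
      rw [Finset.sum_eq_single j]
      · simp
      · intro b _ hb; simp [hb]
      · simp
    · rw [← Finset.sum_sub_distrib]
      refine Finset.sum_congr rfl fun j _ => ?_
      ring
  refine key.congr' fun x _ x' _ => ?_
  rw [integral_sub hI2 (hI fun j => x j - x' j), integral_const_mul,
    integral_finsetSum _ (fun j _ => hI _)]
  rfl

theorem psd_lp {p : ℝ} (hp : 1 < p) (hp2 : p ≤ 2) {n : ℕ} {A : Set (Fin n → ℝ)} {R : ℝ}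
    (hR : ∀ x ∈ A, ∀ j, |x j| ≤ R) :
    ∃ M, PSDK A (fun x y => M - (∑ j, |x j - y j| ^ p) ^ (1 / p)) := by
  obtain ⟨P, c, hP⟩ := exists_goodLaw hp hp2
  have := hP.1
  have := symLaw_prob P
  have hG := Gc_pos hp hP.2.2.1
  have hk := kap_pos one_pos one_lt_two
  set M' := R * ∑ j, Gc p c * (∑ i, |(Pi.single j 1 : Fin n → ℝ) i| ^ p) ^ (1 / p) with hM'
  have key : PSDK A (fun x y => M' - Gc p c * (∑ j, |x j - y j| ^ p) ^ (1 / p)) := by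
    refine PSDK.lim (F := Filter.atTop) (fun (N : ℕ) x y =>
      kap 1 * (R * ∑ j, Fexp p (symLaw P) N (Pi.single j 1 : Fin n → ℝ)
      - Fexp p (symLaw P) N (fun j => x j - y j)))
      (fun N => (psd_Fexp (integrable_symLaw hP.2.1 hP.2.1.neg) N hR).smul hk.le) ?_
    intro x _ y _
    have h1 := Fexp_tendsto hp hP (fun j => x j - y j)
    have h2 := (tendsto_finsetSum (Finset.univ : Finset (Fin n)) fun j _ =>
      Fexp_tendsto hp hP (Pi.single j 1 : Fin n → ℝ)).const_mul R
    refine (h2.sub h1).congr fun N => ?_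
    rw [← Finset.mul_sum]
    ring
  refine ⟨(Gc p c)⁻¹ * M', (key.smul (inv_pos.2 hG).le).congr' fun x _ y _ => ?_⟩
  rw [mul_sub, inv_mul_cancel_left₀ hG.ne']

end Limit

theorem psd_pDist (p α : ℝ) (hp0 : 0 < p) (hp2 : p ≤ 2)
    (hα0 : 0 < α) (hα1 : α ≤ 1) {n : ℕ} {A : Set (Fin n → ℝ)} {R : ℝ}
    (hR : ∀ x ∈ A, ∀ j, |x j| ≤ R) :
    ∃ M, PSDK A (fun x y => M - pDist p α x y) := by
  have hd : ∀ x ∈ A, ∀ y ∈ A, ∀ j, |x j - y j| ≤ 2 * R := fun x hx y hy j => by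
    have h1 := abs_le.1 (hR x hx j)
    have h2 := abs_le.1 (hR y hy j)
    rw [abs_le]; constructor <;> linarith
  have hsum : ∀ x ∈ A, ∀ y ∈ A, ∑ j, |x j - y j| ^ p ≤ ∑ _j : Fin n, (2 * R) ^ p :=
    fun x hx y hy => Finset.sum_le_sum fun j _ =>
      Real.rpow_le_rpow (abs_nonneg _) (hd x hx y hy j) hp0.le
  rcases le_or_gt p 1 with hp1 | hp1
  · have hj : ∀ j : Fin n, ∃ M, PSDK A (fun x y => M - |x j - y j| ^ p) := fun j =>
      PSDK.rpow_sub (s := fun x y => |x j - y j|) (B := 2 * R) hp0 hp1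
        ⟨R, psd_base (fun x => x j) fun x hx => hR x hx j⟩
        (fun x _ y _ => abs_nonneg _) (fun x hx y hy => hd x hx y hy j)
    choose M hM using hj
    have h1 : ∃ M, PSDK A (fun x y => M - ∑ j, |x j - y j| ^ p) :=
      ⟨∑ j, M j, (PSDK.finsetSum Finset.univ _ fun j _ => hM j).congr' fun x _ y _ => by
        rw [Finset.sum_sub_distrib]⟩
    obtain ⟨M', hM'⟩ := PSDK.rpow_sub hα0 hα1 h1 (fun x _ y _ => by positivity) hsum
    refine ⟨M', hM'.congr' fun x _ y _ => ?_⟩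
    unfold pDist
    rw [min_eq_right hp1, ← Real.rpow_mul (by positivity)]
    congr 2
    field_simp
  · obtain ⟨M', hM'⟩ := PSDK.rpow_sub hα0 hα1 (psd_lp hp1 hp2 hR)
      (fun x _ y _ => by positivity)
      (fun x hx y hy => Real.rpow_le_rpow (by positivity) (hsum x hx y hy) (by positivity))
    refine ⟨M', hM'.congr' fun x _ y _ => ?_⟩
    unfold pDist
    rw [min_eq_left hp1.le, mul_one]

theorem statement17 (p α : ℝ) (hp0 : 0 < p) (hp2 : p ≤ 2)
    (hα0 : 0 < α) (hα1 : α ≤ 1) (n : ℕ)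
    (A : Set (Fin n → ℝ)) (hA : IsCompact A) (hAne : A.Nonempty) :
    ∃ C : ℝ, 0 < C ∧
      ∀ μ : SignedMeasure (Fin n → ℝ), μ.totalVariation Aᶜ = 0 →
        (μ Set.univ) ^ 2 ≤
          C * sInt μ (fun x => sInt μ (fun y => Real.exp (-pDist p α x y))) := by
  obtain ⟨R, hR⟩ := hA.isBounded.exists_norm_le
  obtain ⟨M, hM⟩ := psd_pDist p α hp0 hp2 hα0 hα1 (A := A) (R := R)
    (fun x hx j => (norm_le_pi_norm x j).trans (hR x hx))
  refine final_of_psd hA hAne ?_ (fun x y => ?_) hM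
  · unfold pDist Function.uncurry
    have hm : 0 < min 1 p := lt_min one_pos hp0
    refine Continuous.rpow_const ?_ fun _ => Or.inr (by positivity)
    refine Continuous.rpow_const ?_ fun _ => Or.inr (by positivity)
    refine continuous_finsetSum _ fun j _ => ?_
    exact Continuous.rpow_const (by fun_prop) fun _ => Or.inr hp0.le
  · unfold pDist
    positivity
end

section
/- Let d be a metric on ℝⁿ which is translation invariant (d(x+z, y+z) = d(x,y) for all x,y,z), homogeneous of degree β ∈ (0,1] (d(tx, ty) = t^β d(x,y) for all x,y ∈ ℝⁿ and t > 0), and such that (ℝⁿ, d) is a positive definite metric space. Let B = { x ∈ ℝⁿ : d(x,0) ≤ 1 } and let A ⊆ ℝⁿ be a nonempty compact set. Then the magnitude of A (with the metric d) satisfies |A| ≥ vol(A) / (Γ(n/β + 1) · vol(B)), where vol denotes Lebesgue measure on ℝⁿ and Γ is the Gamma function. -/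
open MeasureTheory Metric
open scoped ENNReal

/-- The bilinear form `Z(μ,μ) = ∫∫ e^{-d(x,y)} dμ(x) dμ(y)` associated to a
distance function `d` on `ℝⁿ`. -/
noncomputable def Zd {n : ℕ} (d : (Fin n → ℝ) → (Fin n → ℝ) → ℝ)
    (μ ν : SignedMeasure (Fin n → ℝ)) : ℝ :=
  sInt μ (fun x => sInt ν (fun y => Real.exp (-d x y)))

/-- The magnitude of the compact set `A ⊆ ℝⁿ` with respect to the metric `d`,
valued in `[1,∞]`: the supremum of `μ(A)²/Z(μ,μ)` over finite signed Borel
measures supported on `A` with `Z(μ,μ) ≠ 0`. -/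
noncomputable def magnitudeD {n : ℕ} (d : (Fin n → ℝ) → (Fin n → ℝ) → ℝ)
    (A : Set (Fin n → ℝ)) : ℝ≥0∞ :=
  ⨆ (μ : SignedMeasure (Fin n → ℝ)) (_ : μ.totalVariation Aᶜ = 0 ∧ Zd d μ μ ≠ 0),
    ENNReal.ofReal ((μ Set.univ) ^ 2 / Zd d μ μ)


section helpers

open scoped Pointwise

variable {n : ℕ} {β : ℝ} {d : (Fin n → ℝ) → (Fin n → ℝ) → ℝ}

lemma d_nonneg' (hd0 : ∀ x y, d x y = 0 ↔ x = y) (hdsymm : ∀ x y, d x y = d y x)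
    (hdtri : ∀ x y z, d x z ≤ d x y + d y z) (x y : Fin n → ℝ) : 0 ≤ d x y := by
  have h1 := hdtri x y x
  rw [(hd0 x x).2 rfl, hdsymm y x] at h1
  linarith

lemma d_sub (hdtrans : ∀ x y z, d (x + z) (y + z) = d x y) (x y : Fin n → ℝ) :
    d x y = d (x - y) 0 := by
  have := hdtrans (x - y) 0 y
  simpa using this

lemma d_single (hβ0 : 0 < β) (hd0 : ∀ x y, d x y = 0 ↔ x = y) (hdsymm : ∀ x y, d x y = d y x)
    (hdtrans : ∀ x y z, d (x + z) (y + z) = d x y)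
    (hdhom : ∀ t : ℝ, 0 < t → ∀ x y, d (t • x) (t • y) = t ^ β * d x y)
    (t : ℝ) (e : Fin n → ℝ) : d (t • e) 0 = |t| ^ β * d e 0 := by
  have hpos : ∀ s : ℝ, 0 < s → d (s • e) 0 = s ^ β * d e 0 := by
    intro s hs
    have := hdhom s hs e 0
    simpa using this
  rcases lt_trichotomy t 0 with h | h | h
  · have h1 : d (t • e) 0 = d ((-t) • e) 0 := by
      rw [hdsymm, d_sub hdtrans]; simp
    rw [h1, hpos _ (by linarith), abs_of_neg h]
  · subst h
    simp [(hd0 0 0).2 rfl, Real.zero_rpow hβ0.ne']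
  · rw [hpos t h, abs_of_pos h]

lemma d_sum_le (hd0 : ∀ x y, d x y = 0 ↔ x = y)
    (hdtri : ∀ x y z, d x z ≤ d x y + d y z)
    (hdtrans : ∀ x y z, d (x + z) (y + z) = d x y)
    (s : Finset (Fin n)) (v : Fin n → Fin n → ℝ) :
    d (∑ i ∈ s, v i) 0 ≤ ∑ i ∈ s, d (v i) 0 := by
  induction s using Finset.induction_on with
  | empty => simp [(hd0 0 0).2 rfl]
  | insert a s ha ih =>
    rw [Finset.sum_insert ha, Finset.sum_insert ha]
    have h1 := hdtri (v a + ∑ i ∈ s, v i) (∑ i ∈ s, v i) 0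
    have h2 := d_sub hdtrans (v a + ∑ i ∈ s, v i) (∑ i ∈ s, v i)
    rw [add_sub_cancel_right] at h2
    linarith

lemma d_cont (hβ0 : 0 < β) (hd0 : ∀ x y, d x y = 0 ↔ x = y) (hdsymm : ∀ x y, d x y = d y x)
    (hdtri : ∀ x y z, d x z ≤ d x y + d y z)
    (hdtrans : ∀ x y z, d (x + z) (y + z) = d x y)
    (hdhom : ∀ t : ℝ, 0 < t → ∀ x y, d (t • x) (t • y) = t ^ β * d x y) :
    Continuous fun x => d x 0 := by
  have hb : ∀ x, d x 0 ≤ ∑ i, |x i| ^ β * d (Pi.single i 1) 0 := by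
    intro x
    have hx : x = ∑ i, x i • (Pi.single i (1 : ℝ) : Fin n → ℝ) := by
      ext j; simp [Finset.sum_apply, Pi.single_apply]
    calc d x 0 = d (∑ i, x i • (Pi.single i (1 : ℝ) : Fin n → ℝ)) 0 := by rw [← hx]
      _ ≤ ∑ i, d (x i • (Pi.single i (1 : ℝ) : Fin n → ℝ)) 0 := d_sum_le hd0 hdtri hdtrans _ _
      _ = _ := Finset.sum_congr rfl fun i _ => d_single hβ0 hd0 hdsymm hdtrans hdhom _ _
  rw [continuous_iff_continuousAt]
  intro x₀
  rw [ContinuousAt, tendsto_iff_dist_tendsto_zero]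
  have hG : Filter.Tendsto (fun x : Fin n → ℝ => ∑ i, |(x - x₀) i| ^ β * d (Pi.single i 1) 0)
      (nhds x₀) (nhds 0) := by
    have hc : Continuous (fun x : Fin n → ℝ => ∑ i, |(x - x₀) i| ^ β * d (Pi.single i 1) 0) := by
      refine continuous_finsetSum _ fun i _ => Continuous.mul ?_ continuous_const
      refine Continuous.rpow_const ?_ (fun _ => Or.inr hβ0.le)
      simp only [Pi.sub_apply]
      fun_prop
    have := hc.tendsto x₀
    simpa [Real.zero_rpow hβ0.ne'] using this
  refine squeeze_zero (fun _ => dist_nonneg) (fun x => ?_) hG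
  refine le_trans ?_ (hb (x - x₀))
  rw [← d_sub hdtrans, Real.dist_eq, abs_le]
  have h1 := hdtri x x₀ 0
  have h2 := hdtri x₀ x 0
  rw [hdsymm x₀ x] at h2
  constructor <;> linarith

lemma vol_ball (hβ0 : 0 < β) 
    (hdhom : ∀ t : ℝ, 0 < t → ∀ x y, d (t • x) (t • y) = t ^ β * d x y) (t : ℝ) (ht : 0 < t) :
    volume {x : Fin n → ℝ | d x 0 ≤ t} =
      ENNReal.ofReal (t ^ ((n : ℝ) / β)) * volume {x : Fin n → ℝ | d x 0 ≤ 1} := by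
  have hr : 0 < t ^ (1 / β) := Real.rpow_pos_of_pos ht _
  have hrb : (t ^ (1 / β)) ^ β = t := by
    rw [← Real.rpow_mul ht.le, one_div, inv_mul_cancel₀ hβ0.ne', Real.rpow_one]
  have h1 : {x : Fin n → ℝ | d x 0 ≤ t} = (t ^ (1 / β)) • {x : Fin n → ℝ | d x 0 ≤ 1} := by
    ext x
    rw [Set.mem_smul_set_iff_inv_smul_mem₀ hr.ne']
    simp only [Set.mem_setOf_eq]
    have h2 := hdhom _ hr ((t ^ (1 / β))⁻¹ • x) 0
    rw [smul_inv_smul₀ hr.ne', smul_zero, hrb] at h2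
    rw [h2]
    constructor
    · intro h; nlinarith
    · intro h; nlinarith
  rw [h1, Measure.addHaar_smul]
  congr 2
  rw [abs_of_nonneg (by positivity), Module.finrank_fin_fun, ← Real.rpow_natCast,
    ← Real.rpow_mul ht.le]
  congr 1
  field_simp

lemma lintegral_exp_d (hβ0 : 0 < β) (hm : Measurable fun x => d x 0) (hnn : ∀ x, 0 ≤ d x 0)
    (hdhom : ∀ t : ℝ, 0 < t → ∀ x y, d (t • x) (t • y) = t ^ β * d x y) :
    ∫⁻ x : Fin n → ℝ, ENNReal.ofReal (Real.exp (-d x 0)) =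
      ENNReal.ofReal (Real.Gamma ((n : ℝ) / β + 1)) * volume {x : Fin n → ℝ | d x 0 ≤ 1} := by
  have h1 : ∀ x : Fin n → ℝ, ENNReal.ofReal (Real.exp (-d x 0)) =
      ∫⁻ t in Set.Ioi (0 : ℝ), {p : (Fin n → ℝ) × ℝ | d p.1 0 ≤ p.2}.indicator
        (fun p => ENNReal.ofReal (Real.exp (-p.2))) (x, t) := by
    intro x
    have e1 : ∫⁻ t in Set.Ioi (0 : ℝ), {p : (Fin n → ℝ) × ℝ | d p.1 0 ≤ p.2}.indicator
        (fun p => ENNReal.ofReal (Real.exp (-p.2))) (x, t)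
        = ∫⁻ t in Set.Ioi (0 : ℝ), (Set.Ici (d x 0)).indicator
          (fun t => ENNReal.ofReal (Real.exp (-t))) t := by
      rfl
    rw [e1, setLIntegral_indicator measurableSet_Ici]
    have e2 : (Set.Ici (d x 0) ∩ Set.Ioi 0 : Set ℝ) =ᵐ[volume] Set.Ioi (d x 0) := by
      have h3 : (Set.Ici (d x 0) ∩ Set.Ioi 0 : Set ℝ) =ᵐ[volume]
          (Set.Ioi (d x 0) ∩ Set.Ioi 0 : Set ℝ) :=
        Filter.EventuallyEq.inter Ioi_ae_eq_Ici.symm (Filter.EventuallyEq.refl _ _)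
      rwa [Set.Ioi_inter_Ioi, sup_eq_left.2 (hnn x)] at h3
    rw [setLIntegral_congr e2, ← ofReal_integral_eq_lintegral_ofReal
      (integrableOn_exp_neg_Ioi _) (Filter.Eventually.of_forall fun _ => (Real.exp_pos _).le),
      integral_exp_neg_Ioi]
  have hS : MeasurableSet {p : (Fin n → ℝ) × ℝ | d p.1 0 ≤ p.2} :=
    measurableSet_le (hm.comp measurable_fst) measurable_snd
  simp_rw [h1]
  rw [lintegral_lintegral_swap]
  · have h2 : ∀ t ∈ Set.Ioi (0 : ℝ), ∫⁻ x : Fin n → ℝ,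
        {p : (Fin n → ℝ) × ℝ | d p.1 0 ≤ p.2}.indicator
        (fun p => ENNReal.ofReal (Real.exp (-p.2))) (x, t) =
        ENNReal.ofReal (Real.exp (-t) * t ^ (((n : ℝ) / β + 1) - 1)) *
          volume {x : Fin n → ℝ | d x 0 ≤ 1} := by
      intro t ht
      have e1 : ∫⁻ x : Fin n → ℝ, {p : (Fin n → ℝ) × ℝ | d p.1 0 ≤ p.2}.indicator
        (fun p => ENNReal.ofReal (Real.exp (-p.2))) (x, t)
        = ∫⁻ x : Fin n → ℝ, {x : Fin n → ℝ | d x 0 ≤ t}.indicator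
          (fun _ => ENNReal.ofReal (Real.exp (-t))) x := rfl
      rw [e1, lintegral_indicator_const (measurableSet_le hm measurable_const), vol_ball hβ0 hdhom t ht,
        ← mul_assoc, ENNReal.ofReal_mul (Real.exp_pos _).le, add_sub_cancel_right]
    rw [setLIntegral_congr_fun measurableSet_Ioi h2, lintegral_mul_const _ (by fun_prop)]
    congr 1
    have hg : 0 < (n : ℝ) / β + 1 := by positivity
    rw [Real.Gamma_eq_integral hg, ofReal_integral_eq_lintegral_ofReal
      (Real.GammaIntegral_convergent hg)]
    refine (ae_restrict_iff' measurableSet_Ioi).2 (Filter.Eventually.of_forall fun t ht => ?_)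
    have : (0 : ℝ) < t := ht
    simp only [Pi.zero_apply]
    positivity
  · refine Measurable.aemeasurable ?_
    exact Measurable.indicator (by fun_prop) hS

lemma toJordan_measure (m : Measure (Fin n → ℝ)) [IsFiniteMeasure m] :
    m.toSignedMeasure.toJordanDecomposition =
      JordanDecomposition.mk m 0 Measure.MutuallySingular.zero_right := by
  apply SignedMeasure.toJordanDecomposition_eq
  simp [JordanDecomposition.toSignedMeasure]

lemma Zd_measure (m : Measure (Fin n → ℝ)) [IsFiniteMeasure m] :
    Zd d m.toSignedMeasure m.toSignedMeasure = ∫ x, ∫ y, Real.exp (-d x y) ∂m ∂m := by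
  simp [Zd, sInt, toJordan_measure]

end helpers

theorem statement19 (n : ℕ) (β : ℝ) (hβ0 : 0 < β) (hβ1 : β ≤ 1)
    (d : (Fin n → ℝ) → (Fin n → ℝ) → ℝ)
    (hd0 : ∀ x y, d x y = 0 ↔ x = y)
    (hdsymm : ∀ x y, d x y = d y x)
    (hdtri : ∀ x y z, d x z ≤ d x y + d y z)
    (hdtrans : ∀ x y z, d (x + z) (y + z) = d x y)
    (hdhom : ∀ t : ℝ, 0 < t → ∀ x y, d (t • x) (t • y) = t ^ β * d x y)
    (hpd : ∀ s : Finset (Fin n → ℝ),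
      (Matrix.of fun x y : ↥s => Real.exp (-d (x : Fin n → ℝ) (y : Fin n → ℝ))).PosDef)
    (A : Set (Fin n → ℝ)) (hA : IsCompact A) (hAne : A.Nonempty) :
    ENNReal.ofReal
        ((volume A).toReal /
          (Real.Gamma ((n : ℝ) / β + 1) *
            (volume {x : Fin n → ℝ | d x 0 ≤ 1}).toReal)) ≤
      magnitudeD d A := by
  set V := volume {x : Fin n → ℝ | d x 0 ≤ 1} with hV
  have hcont := d_cont hβ0 hd0 hdsymm hdtri hdtrans hdhom
  have hnn := d_nonneg' hd0 hdsymm hdtri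
  have hI := lintegral_exp_d hβ0 hcont.measurable (fun x => hnn x 0) hdhom
  rw [← hV] at hI
  by_cases hA0 : volume A = 0
  · simp [hA0]
  by_cases hVt : V = ∞
  · simp [hVt]
  have hAfin : volume A ≠ ∞ := hA.measure_lt_top.ne
  have hG : 0 < Real.Gamma ((n : ℝ) / β + 1) := Real.Gamma_pos_of_pos (by positivity)
  have : IsFiniteMeasure (volume.restrict A) := ⟨by simpa using hA.measure_lt_top⟩
  have : NeZero (volume.restrict A) := ⟨by simpa using hA0⟩
  have hZ := Zd_measure (d := d) (volume.restrict A)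
  have hcd : Continuous fun p : (Fin n → ℝ) × (Fin n → ℝ) => d p.1 p.2 := by
    have : (fun p : (Fin n → ℝ) × (Fin n → ℝ) => d p.1 p.2) =
        (fun x => d x 0) ∘ fun p => p.1 - p.2 := by
      ext p; exact d_sub hdtrans _ _
    rw [this]
    exact hcont.comp (by fun_prop)
  have hint : Integrable (fun p : (Fin n → ℝ) × (Fin n → ℝ) => Real.exp (-d p.1 p.2))
      ((volume.restrict A).prod (volume.restrict A)) := by
    refine Integrable.of_bound (C := 1) ?_ (Filter.Eventually.of_forall fun p => ?_)
    · exact (Real.continuous_exp.comp hcd.neg).aestronglyMeasurable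
    · rw [Real.norm_eq_abs, abs_of_pos (Real.exp_pos _)]
      exact Real.exp_le_one_iff.2 (by linarith [hnn p.1 p.2])
  have hZpos : 0 < Zd d (volume.restrict A).toSignedMeasure (volume.restrict A).toSignedMeasure := by
    rw [hZ, ← integral_prod _ hint]
    have : NeZero ((volume.restrict A).prod (volume.restrict A)) := by
      refine ⟨fun h => ?_⟩
      have := congrArg (fun m => m Set.univ) h
      simp [← Set.univ_prod_univ, Measure.prod_prod, hA0] at this
    exact integral_exp_pos hint
  have hinner : ∀ x, ∫ y in A, Real.exp (-d x y) ≤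
      Real.Gamma ((n : ℝ) / β + 1) * V.toReal := by
    intro x
    have hcx : Continuous fun y => Real.exp (-d x y) :=
      Real.continuous_exp.comp
        (hcd.comp (Continuous.prodMk continuous_const continuous_id)).neg
    rw [integral_eq_lintegral_of_nonneg_ae
      (Filter.Eventually.of_forall fun _ => (Real.exp_pos _).le) hcx.aestronglyMeasurable,
      ← ENNReal.toReal_ofReal hG.le, ← ENNReal.toReal_mul, ← hI]
    refine ENNReal.toReal_mono ?_ ?_
    · rw [hI]; exact ENNReal.mul_ne_top ENNReal.ofReal_ne_top hVt
    · refine (setLIntegral_le_lintegral _ _).trans (le_of_eq ?_)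
      have : ∀ y, d x y = d (y - x) 0 := fun y => by rw [hdsymm, d_sub hdtrans]
      simp_rw [this]
      exact lintegral_sub_right_eq_self
        (fun y : Fin n → ℝ => ENNReal.ofReal (Real.exp (-d y 0))) x
  have hZle : Zd d (volume.restrict A).toSignedMeasure (volume.restrict A).toSignedMeasure ≤
      (volume A).toReal * (Real.Gamma ((n : ℝ) / β + 1) * V.toReal) := by
    rw [hZ]
    refine (integral_mono_of_nonneg (Filter.Eventually.of_forall fun x => ?_)
      (integrable_const _) (Filter.Eventually.of_forall hinner)).trans (le_of_eq ?_)
    · exact integral_nonneg fun _ => (Real.exp_pos _).le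
    · simp [Measure.real]
  have hAp : 0 < (volume A).toReal := ENNReal.toReal_pos hA0 hAfin
  have hKp : 0 < Real.Gamma ((n : ℝ) / β + 1) * V.toReal :=
    pos_of_mul_pos_right (hZpos.trans_le hZle) hAp.le
  refine le_trans ?_ (le_iSup₂_of_le (volume.restrict A).toSignedMeasure
    ⟨?_, hZpos.ne'⟩ le_rfl)
  · apply ENNReal.ofReal_le_ofReal
    have hu : (volume.restrict A).toSignedMeasure Set.univ = (volume A).toReal := by
      rw [Measure.toSignedMeasure_apply_measurable MeasurableSet.univ]
      simp [Measure.real]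
    rw [hu, div_le_div_iff₀ hKp hZpos]
    nlinarith
  · simp [SignedMeasure.totalVariation, toJordan_measure,
      Measure.restrict_apply hA.measurableSet.compl]
end
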